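/- (Robust α-theorem.) Let g : ℂⁿ → ℂⁿ be a square polynomial system and ẑ ∈ ℂⁿ a point with Dg(ẑ) invertible such that α(g,ẑ) < 0.03, and let ζ be the associated solution, i.e. the zero of g to which the Newton iterates N_g^k(ẑ) converge. If ẑ' ∈ ℂⁿ satisfies ‖ẑ − ẑ'‖ < 1/(20·γ(g,ẑ)), then the Newton iterates N_g^k(ẑ') are all defined and converge to the same zero ζ of g. -/

import Mathlib

open MvPolynomial Filter Topology

/-- The Newton operator `N_g(z) = z − Dg(z)⁻¹ g(z)` of a map `g : ℂⁿ → ℂⁿ`, written with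
`ContinuousLinearMap.inverse` (which is the inverse where the Jacobian is invertible,
and the zero map elsewhere). -/
noncomputable def newtonMap {n : ℕ} (g : EuclideanSpace ℂ (Fin n) → EuclideanSpace ℂ (Fin n))
    (z : EuclideanSpace ℂ (Fin n)) : EuclideanSpace ℂ (Fin n) :=
  z - (fderiv ℂ g z).inverse (g z)

/-- The Jacobian of `g` at `z` is invertible, i.e. it is a continuous linear isomorphism. -/
def jacobianInvertible {n : ℕ} (g : EuclideanSpace ℂ (Fin n) → EuclideanSpace ℂ (Fin n))
    (z : EuclideanSpace ℂ (Fin n)) : Prop :=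
  ∃ e : EuclideanSpace ℂ (Fin n) ≃L[ℂ] EuclideanSpace ℂ (Fin n),
    (e : EuclideanSpace ℂ (Fin n) →L[ℂ] EuclideanSpace ℂ (Fin n)) = fderiv ℂ g z

/-- `β(g, zhat) = ‖Dg(zhat)⁻¹ g(zhat)‖`, the length of a Newton step. -/
noncomputable def betaVal {n : ℕ} (g : EuclideanSpace ℂ (Fin n) → EuclideanSpace ℂ (Fin n))
    (zhat : EuclideanSpace ℂ (Fin n)) : ℝ :=
  ‖(fderiv ℂ g zhat).inverse (g zhat)‖

/-- `γ(g, zhat) = sup_{k ≥ 2} ‖Dg(zhat)⁻¹ ∘ (1/k!)·Dᵏg(zhat)‖^{1/(k−1)}`. -/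
noncomputable def gammaVal {n : ℕ} (g : EuclideanSpace ℂ (Fin n) → EuclideanSpace ℂ (Fin n))
    (zhat : EuclideanSpace ℂ (Fin n)) : ℝ :=
  ⨆ k : ℕ, if 2 ≤ k then
      (‖((fderiv ℂ g zhat).inverse).compContinuousMultilinearMap
          (iteratedFDeriv ℂ k g zhat)‖ / (k.factorial : ℝ)) ^ (((k : ℝ) - 1)⁻¹)
    else 0

/-- `α(g, zhat) = β(g, zhat) · γ(g, zhat)`. -/
noncomputable def alphaVal {n : ℕ} (g : EuclideanSpace ℂ (Fin n) → EuclideanSpace ℂ (Fin n))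
    (zhat : EuclideanSpace ℂ (Fin n)) : ℝ :=
  betaVal g zhat * gammaVal g zhat

open scoped ContDiff

/-- Smooth with vanishing high order derivatives. -/
def FinPoly {E F : Type*} [NormedAddCommGroup E] [NormedSpace ℂ E] [NormedAddCommGroup F]
    [NormedSpace ℂ F] (f : E → F) : Prop :=
  ContDiff ℂ ∞ f ∧ ∃ N : ℕ, ∀ k, N ≤ k → ∀ x, iteratedFDeriv ℂ k f x = 0

section FinPoly
variable {E F G : Type*} [NormedAddCommGroup E] [NormedSpace ℂ E] [NormedAddCommGroup F]
    [NormedSpace ℂ F] [NormedAddCommGroup G] [NormedSpace ℂ G]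

theorem cdk {f : E → F} (h : ContDiff ℂ ∞ f) (k : ℕ) : ContDiff ℂ k f :=
  h.of_le (by exact_mod_cast le_top)

theorem FinPoly.const (c : F) : FinPoly (fun _ : E => c) := by
  refine ⟨contDiff_const, 1, fun k hk x => ?_⟩
  rw [iteratedFDeriv_const_of_ne (by omega)]; rfl

theorem FinPoly.clm (L : E →L[ℂ] F) : FinPoly (fun x => L x) := by
  refine ⟨L.contDiff, 2, fun k hk x => ?_⟩
  obtain ⟨m, rfl⟩ := Nat.exists_eq_add_of_le hk
  rw [← norm_eq_zero, show 2 + m = (m + 1) + 1 by ring, ← norm_iteratedFDeriv_fderiv]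
  have : fderiv ℂ (fun x => L x) = fun _ => L := by
    funext y; exact L.hasFDerivAt.fderiv
  rw [this, iteratedFDeriv_succ_const]; simp

theorem FinPoly.add {f g : E → F} (hf : FinPoly f) (hg : FinPoly g) :
    FinPoly (fun x => f x + g x) := by
  obtain ⟨hf, N, hN⟩ := hf
  obtain ⟨hg, M, hM⟩ := hg
  refine ⟨hf.add hg, N + M, fun k hk x => ?_⟩
  have := iteratedFDeriv_add_apply (cdk hf k).contDiffAt (cdk hg k).contDiffAt (x := x)
  rw [hN k (by omega), hM k (by omega)] at this
  rw [add_zero] at this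
  exact this

theorem FinPoly.mul {f g : E → ℂ} (hf : FinPoly f) (hg : FinPoly g) :
    FinPoly (fun x => f x * g x) := by
  obtain ⟨hf, N, hN⟩ := hf
  obtain ⟨hg, M, hM⟩ := hg
  refine ⟨hf.mul hg, N + M, fun k hk x => ?_⟩
  rw [← norm_eq_zero]
  refine le_antisymm ?_ (norm_nonneg _)
  refine (norm_iteratedFDeriv_mul_le hf hg x (n := k) (by exact_mod_cast le_top)).trans ?_
  refine (Finset.sum_eq_zero fun i hi => ?_).le
  by_cases h : N ≤ i
  · rw [hN i h]; simp
  · rw [hM (k - i) (by omega)]; simp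

theorem FinPoly.comp_left {f : E → F} (hf : FinPoly f) (L : F →L[ℂ] G) :
    FinPoly (fun x => L (f x)) := by
  obtain ⟨hf, N, hN⟩ := hf
  refine ⟨L.contDiff.comp hf, N, fun k hk x => ?_⟩
  have := L.iteratedFDeriv_comp_left (cdk hf k).contDiffAt (x := x) le_rfl
  rw [hN k hk] at this
  refine this.trans ?_
  ext; simp

theorem FinPoly.sum {ι : Type*} (s : Finset ι) {f : ι → E → F} (h : ∀ i ∈ s, FinPoly (f i)) :
    FinPoly (fun x => ∑ i ∈ s, f i x) := by
  classical
  induction s using Finset.induction_on with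
  | empty => simpa using FinPoly.const (0 : F)
  | insert a s ha ih =>
    simp only [Finset.sum_insert ha]
    exact (h a (by simp)).add (ih fun i hi => h i (by simp [hi]))

end FinPoly

theorem finPoly_of_poly {n : ℕ} (g : EuclideanSpace ℂ (Fin n) → EuclideanSpace ℂ (Fin n))
    (hpoly : ∃ p : Fin n → MvPolynomial (Fin n) ℂ,
      ∀ (z : EuclideanSpace ℂ (Fin n)) (j : Fin n),
        g z j = MvPolynomial.eval (fun i => z i) (p j)) : FinPoly g := by
  obtain ⟨p, hp⟩ := hpoly
  have key : ∀ q : MvPolynomial (Fin n) ℂ,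
      FinPoly (fun z : EuclideanSpace ℂ (Fin n) => MvPolynomial.eval (fun i => z i) q) := by
    intro q
    induction q using MvPolynomial.induction_on with
    | C a => simpa using FinPoly.const a
    | add p q hp hq => simpa using hp.add hq
    | mul_X p i hp =>
      simpa using hp.mul (FinPoly.clm (EuclideanSpace.proj i : EuclideanSpace ℂ (Fin n) →L[ℂ] ℂ))
  have e : g = fun z => ∑ j, ((1 : ℂ →L[ℂ] ℂ).smulRight (EuclideanSpace.single j (1 : ℂ)))
      (MvPolynomial.eval (fun i => z i) (p j)) := by
    funext z
    ext i
    simp [hp, Pi.single_apply]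
  rw [e]
  exact FinPoly.sum _ fun j _ => (key (p j)).comp_left _

/-- Majorant bound on the derivatives near the base point. -/
theorem deriv_bound {E F : Type*} [NormedAddCommGroup E] [NormedSpace ℂ E] [NormedAddCommGroup F]
    [NormedSpace ℂ F] {f : E → F} (hf : FinPoly f) (a : E) (γ : ℝ) (hγ : 0 ≤ γ)
    (h : ∀ m : ℕ, ‖iteratedFDeriv ℂ (m + 2) f a‖ ≤ (m + 2).factorial * γ ^ (m + 1)) (m : ℕ) :
    ∀ x : E, γ * ‖x‖ < 1 → ‖iteratedFDeriv ℂ (m + 2) f (a + x)‖ ≤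
      (m + 2).factorial * γ ^ (m + 1) / (1 - γ * ‖x‖) ^ (m + 3) := by
  obtain ⟨hf, N, hN⟩ := hf
  by_cases hm : N ≤ m + 2
  · intro x hx
    rw [hN _ hm, norm_zero]
    have : 0 < 1 - γ * ‖x‖ := by linarith
    positivity
  · induction hd : N - (m + 2) generalizing m with
    | zero => omega
    | succ d ih =>
    intro x hx
    have ih' : ∀ y : E, γ * ‖y‖ < 1 → ‖iteratedFDeriv ℂ (m + 1 + 2) f (a + y)‖ ≤
      (m + 1 + 2).factorial * γ ^ (m + 1 + 1) / (1 - γ * ‖y‖) ^ (m + 1 + 3) := by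
      by_cases h2 : N ≤ m + 1 + 2
      · intro y hy
        rw [hN _ h2, norm_zero]
        have : 0 < 1 - γ * ‖y‖ := by linarith
        positivity
      · exact ih (m + 1) h2 (by omega)
    let _ : NormedSpace ℝ E := NormedSpace.restrictScalars ℝ ℂ E
    let _ : NormedSpace ℝ (E [×(m + 2)]→L[ℂ] F) := NormedSpace.restrictScalars ℝ ℂ _
    have hpos : ∀ t ∈ Set.Icc (0 : ℝ) 1, 0 < 1 - γ * (t * ‖x‖) := by
      intro t ht
      have : γ * (t * ‖x‖) ≤ γ * (1 * ‖x‖) := by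
        have := ht.2
        gcongr
      linarith
    have hD : Differentiable ℂ (iteratedFDeriv ℂ (m + 2) f) :=
      (cdk hf (m + 3)).differentiable_iteratedFDeriv (by exact_mod_cast Nat.lt_succ_self _)
    have hder : ∀ t : ℝ, HasDerivAt (fun t : ℝ => iteratedFDeriv ℂ (m + 2) f (a + (t : ℂ) • x))
        (fderiv ℂ (iteratedFDeriv ℂ (m + 2) f) (a + (t : ℂ) • x) x) t := by
      intro t
      have h1 : HasDerivAt (fun s : ℂ => a + s • x) x (t : ℂ) := by
        simpa using ((hasDerivAt_id (t : ℂ)).smul_const x).const_add a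
      have h2 := (hD (a + (t : ℂ) • x)).hasFDerivAt.comp_hasDerivAt (t : ℂ) h1
      have h3 := HasDerivAt.scomp (𝕜 := ℝ) (h := fun s : ℝ => (s : ℂ)) t h2
        (Complex.ofRealCLM.hasDerivAt (x := t))
      simpa [Function.comp_def] using h3
    have hB : ∀ t ∈ Set.Icc (0 : ℝ) 1, HasDerivAt
        (fun t : ℝ => ((m + 2).factorial * γ ^ (m + 1) / (1 - γ * (t * ‖x‖)) ^ (m + 3) : ℝ))
        ((m + 1 + 2).factorial * γ ^ (m + 1 + 1) / (1 - γ * (t * ‖x‖)) ^ (m + 1 + 3) * ‖x‖) t := by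
      intro t ht
      have hp := hpos t ht
      have h1 : HasDerivAt (fun t : ℝ => 1 - γ * (t * ‖x‖)) (-(γ * ‖x‖)) t := by
        simpa using (((hasDerivAt_id t).mul_const ‖x‖).const_mul γ).const_sub 1
      have h2 := ((h1.fun_pow (m + 3)).fun_inv (by positivity)).const_mul
        ((m + 2).factorial * γ ^ (m + 1) : ℝ)
      refine HasDerivAt.congr_deriv (f' := _) (by simpa only [div_eq_mul_inv] using h2) ?_
      rw [show (m + 1 + 2).factorial = ((m + 2) + 1).factorial from rfl, Nat.factorial_succ (m + 2)]
      have : m + 3 - 1 = m + 2 := by omega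
      rw [this]
      push_cast
      have hne := hp.ne'
      generalize 1 - γ * (t * ‖x‖) = c at hne
      generalize ((m + 2).factorial : ℝ) = d
      field_simp
      try ring
    have := image_norm_le_of_norm_deriv_right_le_deriv_boundary' (a := (0 : ℝ)) (b := 1)
      (fun t _ => (hder t).continuousAt.continuousWithinAt)
      (fun t _ => (hder t).hasDerivWithinAt)
      (B := fun t : ℝ => ((m + 2).factorial * γ ^ (m + 1) / (1 - γ * (t * ‖x‖)) ^ (m + 3) : ℝ))
      (by simpa using h m)
      (fun t ht => (hB t ht).continuousAt.continuousWithinAt)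
      (fun t ht => (hB t (Set.Ico_subset_Icc_self ht)).hasDerivWithinAt)
      (by
        intro t ht
        have hn : ‖(t : ℂ) • x‖ = t * ‖x‖ := by
          rw [norm_smul, Complex.norm_real, Real.norm_of_nonneg ht.1]
        refine (ContinuousLinearMap.le_opNorm _ _).trans ?_
        rw [norm_fderiv_iteratedFDeriv]
        have h3 := ih' ((t : ℂ) • x) (by
          rw [hn]; linarith [hpos t (Set.Ico_subset_Icc_self ht)])
        rw [hn] at h3
        gcongr)
      (Set.right_mem_Icc.2 zero_le_one)
    simpa using this

theorem gamma_bound {n : ℕ} {g : EuclideanSpace ℂ (Fin n) → EuclideanSpace ℂ (Fin n)}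
    (hg : FinPoly g) (a : EuclideanSpace ℂ (Fin n)) :
    0 ≤ gammaVal g a ∧ ∀ m : ℕ,
    ‖iteratedFDeriv ℂ (m + 2) (fun z => (fderiv ℂ g a).inverse (g z)) a‖ ≤
      (m + 2).factorial * gammaVal g a ^ (m + 1) := by
  obtain ⟨hg, N, hN⟩ := hg
  set u : ℕ → ℝ := fun k => if 2 ≤ k then
      (‖((fderiv ℂ g a).inverse).compContinuousMultilinearMap
          (iteratedFDeriv ℂ k g a)‖ / (k.factorial : ℝ)) ^ (((k : ℝ) - 1)⁻¹)
    else 0 with hu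
  have hγ : gammaVal g a = ⨆ k, u k := rfl
  have hnn : ∀ k, 0 ≤ u k := by
    intro k
    simp only [hu]
    split_ifs <;> positivity
  have hbdd : BddAbove (Set.range u) := by
    refine (Set.Finite.subset ((Set.finite_Iio (N + 2)).image u |>.union (Set.finite_singleton 0))
      ?_).bddAbove
    rintro _ ⟨k, rfl⟩
    by_cases hk : k < N + 2
    · exact Or.inl ⟨k, hk, rfl⟩
    · right
      have h2 : 2 ≤ k := by omega
      have h3 : (k : ℝ) - 1 ≠ 0 := by
        have : (2 : ℝ) ≤ k := by exact_mod_cast h2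
        linarith
      have h4 : ((fderiv ℂ g a).inverse).compContinuousMultilinearMap
          (0 : (EuclideanSpace ℂ (Fin n)) [×k]→L[ℂ] (EuclideanSpace ℂ (Fin n))) = 0 := by
        ext; simp
      simp [hu, h2, hN k (by omega), h4, Real.zero_rpow (inv_ne_zero h3)]
  refine ⟨hγ ▸ Real.iSup_nonneg hnn, fun m => ?_⟩
  have h1 := le_ciSup hbdd (m + 2)
  rw [← hγ] at h1
  have e := (fderiv ℂ g a).inverse.iteratedFDeriv_comp_left (cdk hg (m + 2)).contDiffAt
    (x := a) le_rfl
  change iteratedFDeriv ℂ (m + 2) (fun z => (fderiv ℂ g a).inverse (g z)) a = _ at e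
  rw [e]
  simp only [hu, show 2 ≤ m + 2 by omega, if_true] at h1
  set q := ‖((fderiv ℂ g a).inverse).compContinuousMultilinearMap
          (iteratedFDeriv ℂ (m + 2) g a)‖ with hq
  have hq0 : 0 ≤ q / ((m + 2).factorial : ℝ) := by positivity
  have h2 := pow_le_pow_left₀ (by positivity) h1 (m + 1)
  rw [← Real.rpow_natCast, ← Real.rpow_mul hq0] at h2
  have h3 : (((m + 2 : ℕ) : ℝ) - 1)⁻¹ * ((m + 1 : ℕ) : ℝ) = 1 := by
    have : (m : ℝ) + 1 ≠ 0 := by positivity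
    push_cast
    rw [show (m : ℝ) + 2 - 1 = m + 1 by ring]
    field_simp
  rw [h3, Real.rpow_one, div_le_iff₀ (by positivity)] at h2
  linarith

/-- Contraction property of the Newton map. -/
theorem newton_core {E : Type*} [NormedAddCommGroup E] [NormedSpace ℂ E] [CompleteSpace E]
    {F : E → E} (hF : FinPoly F) (a : E) (γ : ℝ) (hγ : 0 < γ)
    (h : ∀ m : ℕ, ‖iteratedFDeriv ℂ (m + 2) F a‖ ≤ (m + 2).factorial * γ ^ (m + 1))
    (hid : fderiv ℂ F a = 1) :
    (∀ z, γ * ‖z - a‖ ≤ 1 / 20 → ∃ e : E ≃L[ℂ] E, (e : E →L[ℂ] E) = fderiv ℂ F z) ∧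
    ∀ z w, γ * ‖z - a‖ ≤ 1 / 20 → γ * ‖w - a‖ ≤ 1 / 20 → ∀ e e' : E ≃L[ℂ] E,
      (e : E →L[ℂ] E) = fderiv ℂ F z → (e' : E →L[ℂ] E) = fderiv ℂ F w →
      0.88 * ‖(z - e.symm (F z)) - (w - e'.symm (F w))‖ ≤
        2.4 * γ * ‖z - w‖ * (‖z - w‖ + ‖e'.symm (F w)‖) := by
  let _ : NormedSpace ℝ E := NormedSpace.restrictScalars ℝ ℂ E
  set S : Set E := Metric.closedBall a (1 / (20 * γ)) with hS
  have hmem : ∀ z, z ∈ S ↔ γ * ‖z - a‖ ≤ 1 / 20 := by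
    intro z
    rw [hS, mem_closedBall_iff_norm, le_div_iff₀ (by positivity), le_div_iff₀ (by positivity)]
    constructor <;> intro h <;> nlinarith
  have hconv : Convex ℝ S := convex_closedBall _ _
  have haS : a ∈ S := by rw [hmem]; simp
  have hd1 : Differentiable ℂ F := hF.1.differentiable (by simp)
  have hd2 : Differentiable ℂ (fderiv ℂ F) :=
    ((cdk hF.1 2).fderiv_right (m := 1) (by norm_num)).differentiable (by simp)
  have hb : ∀ z ∈ S, ‖fderiv ℂ (fderiv ℂ F) z‖ ≤ 2.4 * γ := by
    intro z hz
    rw [hmem] at hz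
    have := deriv_bound hF a γ hγ.le h 0 (z - a) (by linarith)
    rw [add_sub_cancel, ← norm_iteratedFDeriv_fderiv, norm_iteratedFDeriv_one] at this
    refine this.trans ?_
    have h3 : (0.95 : ℝ) ^ 3 ≤ (1 - γ * ‖z - a‖) ^ 3 :=
      pow_le_pow_left₀ (by norm_num) (by linarith) 3
    simp only [zero_add, pow_one]
    rw [div_le_iff₀ (by linarith [show (0 : ℝ) < 0.95 ^ 3 by norm_num])]
    norm_num [Nat.factorial] at h3 ⊢
    nlinarith
  have hL : ∀ z ∈ S, ∀ w ∈ S, ‖fderiv ℂ F z - fderiv ℂ F w‖ ≤ 2.4 * γ * ‖z - w‖ :=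
    fun z hz w hw => hconv.norm_image_sub_le_of_norm_fderiv_le (fun x _ => hd2 x) hb hw hz
  have h12 : ∀ z ∈ S, ‖fderiv ℂ F z - 1‖ ≤ 0.12 := by
    intro z hz
    have := hL z hz a haS
    rw [hid] at this
    rw [hmem] at hz
    linarith
  have hlow : ∀ z ∈ S, ∀ x, 0.88 * ‖x‖ ≤ ‖fderiv ℂ F z x‖ := by
    intro z hz x
    have h1 : ‖(fderiv ℂ F z - 1) x‖ ≤ 0.12 * ‖x‖ :=
      (ContinuousLinearMap.le_opNorm _ _).trans (by gcongr; exact h12 z hz)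
    have h2 : x = fderiv ℂ F z x - (fderiv ℂ F z - 1) x := by simp
    have h3 := norm_sub_le (fderiv ℂ F z x) ((fderiv ℂ F z - 1) x)
    rw [← h2] at h3
    linarith
  refine ⟨fun z hz => ?_, fun z w hz hw e e' he he' => ?_⟩
  · have h1 := h12 z ((hmem z).2 hz)
    rw [norm_sub_rev] at h1
    refine ⟨ContinuousLinearEquiv.ofUnit (Units.oneSub (1 - fderiv ℂ F z) (by linarith)), ?_⟩
    ext x
    change ((Units.oneSub (1 - fderiv ℂ F z) (by linarith) : (E →L[ℂ] E)ˣ) : E →L[ℂ] E) x = _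
    simp
  · rw [← hmem] at hz hw
    have hseg : segment ℝ w z ⊆ S := hconv.segment_subset hw hz
    have h1 : ‖F w - F z - fderiv ℂ F z (w - z)‖ ≤ 2.4 * γ * ‖z - w‖ * ‖w - z‖ := by
      refine (convex_segment w z).norm_image_sub_le_of_norm_fderiv_le' (𝕜 := ℂ)
        (fun x _ => hd1 x) (fun x hx => ?_) (right_mem_segment _ _ _) (left_mem_segment _ _ _)
      refine (hL x (hseg hx) z hz).trans ?_
      gcongr
      have := norm_sub_le_of_mem_segment (segment_symm ℝ w z ▸ hx)
      rwa [norm_sub_rev z w]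
    set v := e'.symm (F w) with hv
    have hev : fderiv ℂ F w v = F w := by rw [← he']; simp [hv]
    have hez : fderiv ℂ F z (e.symm (F z)) = F z := by rw [← he]; simp
    have h2 : ‖(fderiv ℂ F z - fderiv ℂ F w) v‖ ≤ 2.4 * γ * ‖z - w‖ * ‖v‖ :=
      (ContinuousLinearMap.le_opNorm _ _).trans (by gcongr; exact hL z hz w hw)
    refine (hlow z hz _).trans ?_
    have h3 : fderiv ℂ F z (z - e.symm (F z) - (w - v)) =
        (F w - F z - fderiv ℂ F z (w - z)) + (fderiv ℂ F z - fderiv ℂ F w) v := by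
      simp only [map_sub, sub_apply, hez, hev]
      abel
    rw [h3]
    refine (norm_add_le _ _).trans ?_
    rw [norm_sub_rev w z] at h1
    linarith

/-- **Robust α-theorem.** If `g` is a square polynomial system, `α(g, zhat) < 0.03`,
the Newton iterates of `zhat` converge to a zero `ζ` of `g`, and
`‖zhat − zhat'‖ < 1/(20·γ(g, zhat))`, then the Newton iterates of `zhat'` are all defined
and converge to the same zero `ζ`. -/
theorem robust_alpha_theorem (n : ℕ)
    (g : EuclideanSpace ℂ (Fin n) → EuclideanSpace ℂ (Fin n))
    (hpoly : ∃ p : Fin n → MvPolynomial (Fin n) ℂ,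
      ∀ (z : EuclideanSpace ℂ (Fin n)) (j : Fin n),
        g z j = MvPolynomial.eval (fun i => z i) (p j))
    (zhat : EuclideanSpace ℂ (Fin n))
    (hinv : jacobianInvertible g zhat)
    (hα : alphaVal g zhat < 0.03)
    (ζ : EuclideanSpace ℂ (Fin n)) (hζzero : g ζ = 0)
    (hζlim : Tendsto (fun k => (newtonMap g)^[k] zhat) atTop (𝓝 ζ))
    (zhat' : EuclideanSpace ℂ (Fin n))
    (hclose : ‖zhat - zhat'‖ < 1 / (20 * gammaVal g zhat)) :
    (∀ k : ℕ, jacobianInvertible g ((newtonMap g)^[k] zhat')) ∧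
      Tendsto (fun k => (newtonMap g)^[k] zhat') atTop (𝓝 ζ) := by
  have hg := finPoly_of_poly g hpoly
  obtain ⟨hγ0, hγb⟩ := gamma_bound hg zhat
  set γ := gammaVal g zhat with hγdef
  have hγ : 0 < γ := by
    rcases hγ0.lt_or_eq with h | h
    · exact h
    · rw [← h] at hclose
      simp at hclose
      exact absurd hclose (not_lt.2 (norm_nonneg _))
  obtain ⟨e0, he0⟩ := hinv
  have hA : (fderiv ℂ g zhat).inverse = (e0.symm : _ →L[ℂ] _) := by
    rw [← he0, ContinuousLinearMap.inverse_equiv]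
  set F : EuclideanSpace ℂ (Fin n) → EuclideanSpace ℂ (Fin n) := fun z => e0.symm (g z) with hFdef
  rw [hA] at hγb
  change ∀ m : ℕ, ‖iteratedFDeriv ℂ (m + 2) F zhat‖ ≤ _ at hγb
  have hF : FinPoly F := 
    hg.comp_left (e0.symm : EuclideanSpace ℂ (Fin n) →L[ℂ] EuclideanSpace ℂ (Fin n))
  have hgd : Differentiable ℂ g := hg.1.differentiable (by simp)
  have hFd : ∀ z, fderiv ℂ F z = (e0.symm : _ →L[ℂ] _).comp (fderiv ℂ g z) := fun z =>
    ((e0.symm : EuclideanSpace ℂ (Fin n) →L[ℂ] EuclideanSpace ℂ (Fin n)).hasFDerivAt.comp z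
      (hgd z).hasFDerivAt).fderiv
  have hid : fderiv ℂ F zhat = 1 := by
    rw [hFd, ← he0]; ext x; simp
  obtain ⟨hex, hcon⟩ := newton_core hF zhat γ hγ hγb hid
  have hgz : ∀ z (e : EuclideanSpace ℂ (Fin n) ≃L[ℂ] EuclideanSpace ℂ (Fin n)),
      (e : _ →L[ℂ] _) = fderiv ℂ F z →
      ((e.trans e0 : EuclideanSpace ℂ (Fin n) ≃L[ℂ] EuclideanSpace ℂ (Fin n)) : _ →L[ℂ] _)
        = fderiv ℂ g z := by
    intro z e he
    ext1 x
    have : e x = fderiv ℂ F z x := by rw [← he]; rfl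
    simp [this, hFd]
  have hN : ∀ z (e : EuclideanSpace ℂ (Fin n) ≃L[ℂ] EuclideanSpace ℂ (Fin n)),
      (e : _ →L[ℂ] _) = fderiv ℂ F z → newtonMap g z = z - e.symm (F z) := by
    intro z e he
    rw [newtonMap, ← hgz z e he, ContinuousLinearMap.inverse_equiv]
    rfl
  have h0 : γ * ‖zhat - zhat‖ ≤ 1 / 20 := by simp
  have hβ : γ * ‖F zhat‖ < 0.03 := by
    have : alphaVal g zhat = ‖F zhat‖ * γ := by
      rw [alphaVal, betaVal, hA, hγdef]; rfl
    linarith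
  -- invariance of the ball
  have hinvar : ∀ z, γ * ‖z - zhat‖ ≤ 1 / 20 → γ * ‖newtonMap g z - zhat‖ ≤ 1 / 20 := by
    intro z hz
    obtain ⟨e, he⟩ := hex z hz
    have h1 := hcon z zhat hz h0 e (ContinuousLinearEquiv.refl ℂ _) he (by rw [hid]; rfl)
    rw [← hN z e he] at h1
    simp only [ContinuousLinearEquiv.refl_symm, ContinuousLinearEquiv.refl_apply] at h1
    have h2 : ‖newtonMap g z - zhat‖ ≤ ‖newtonMap g z - (zhat - F zhat)‖ + ‖F zhat‖ := by
      have := norm_sub_le (newtonMap g z - (zhat - F zhat)) (F zhat)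
      rwa [show newtonMap g z - (zhat - F zhat) - F zhat = newtonMap g z - zhat by abel] at this
    have h3 := mul_le_mul_of_nonneg_left h1 hγ.le
    have h4 := mul_le_mul_of_nonneg_left h2 hγ.le
    have h5 : (γ * ‖z - zhat‖) * (γ * ‖z - zhat‖ + γ * ‖F zhat‖) ≤ (1 / 20) * (1 / 20 + 0.03) := by
      gcongr
    nlinarith
  have hcontr : ∀ z w, γ * ‖z - zhat‖ ≤ 1 / 20 → γ * ‖w - zhat‖ ≤ 1 / 20 →
      ‖newtonMap g z - newtonMap g w‖ ≤ 0.6 * ‖z - w‖ := by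
    intro z w hz hw
    obtain ⟨e, he⟩ := hex z hz
    obtain ⟨e', he'⟩ := hex w hw
    have h1 := hcon z w hz hw e e' he he'
    have hw' := hinvar w hw
    have h2 : ‖e'.symm (F w)‖ ≤ ‖w - zhat‖ + ‖newtonMap g w - zhat‖ := by
      have := norm_sub_le (w - zhat) (newtonMap g w - zhat)
      rwa [show (w - zhat) - (newtonMap g w - zhat) = e'.symm (F w) by
        rw [hN w e' he']; abel] at this
    rw [← hN z e he, ← hN w e' he'] at h1
    have h3 : ‖z - w‖ ≤ ‖z - zhat‖ + ‖w - zhat‖ := by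
      have := norm_sub_le (z - zhat) (w - zhat)
      rwa [sub_sub_sub_cancel_right] at this
    have h4 : γ * (‖z - w‖ + ‖e'.symm (F w)‖) ≤ 1 / 5 := by nlinarith
    have h5 := mul_le_mul_of_nonneg_left h4 (norm_nonneg (z - w))
    have := norm_nonneg (z - w)
    nlinarith
  have hz' : γ * ‖zhat' - zhat‖ ≤ 1 / 20 := by
    rw [norm_sub_rev, lt_div_iff₀ (by positivity)] at hclose
    linarith
  have hit : ∀ z, γ * ‖z - zhat‖ ≤ 1 / 20 → ∀ k, γ * ‖(newtonMap g)^[k] z - zhat‖ ≤ 1 / 20 := by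
    intro z hz k
    induction k with
    | zero => simpa using hz
    | succ k ih => rw [Function.iterate_succ_apply']; exact hinvar _ ih
  have hdist : ∀ k, ‖(newtonMap g)^[k] zhat' - (newtonMap g)^[k] zhat‖
      ≤ 0.6 ^ k * ‖zhat' - zhat‖ := by
    intro k
    induction k with
    | zero => simp
    | succ k ih =>
      rw [Function.iterate_succ_apply', Function.iterate_succ_apply', pow_succ]
      have := hcontr _ _ (hit _ hz' k) (hit _ h0 k)
      linarith
  refine ⟨fun k => ?_, ?_⟩
  · obtain ⟨e, he⟩ := hex _ (hit _ hz' k)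
    exact ⟨_, hgz _ e he⟩
  · have ht : Tendsto (fun k : ℕ => (0.6 : ℝ) ^ k * ‖zhat' - zhat‖) atTop (𝓝 0) := by
      simpa using (tendsto_pow_atTop_nhds_zero_of_lt_one (r := (0.6 : ℝ)) (by norm_num)
        (by norm_num)).mul_const ‖zhat' - zhat‖
    have hd := (squeeze_zero_norm hdist ht).add hζlim
    simpa using hd
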